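/- Let (X,ω) be a hermitian complex threefold with holomorphic volume form Ω satisfying the conformally balanced condition d(‖Ω‖_ω ω²) = 0, and set T = i(∂−∂̄)ω. Then the Levi-Civita Laplacian of log ‖Ω‖_ω satisfies ∇² log ‖Ω‖_ω = −(i∂∂̄ω)_α{}^{αμ}{}_μ + T_{αμν̄} T^{μν̄ α} − T_α{}^{μα} ∂_μ log ‖Ω‖_ω + T_α{}^{μ̄α} ∂_{μ̄} log ‖Ω‖_ω. -/

import Mathlib

noncomputable section

/-!
# Statement 16

Let `(X,ω)` be a hermitian complex threefold with holomorphic volume form `Ω` satisfying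
the conformally balanced condition `d(‖Ω‖_ω ω²) = 0`, and set `T = i(∂−∂̄)ω`.  Then the
Levi-Civita Laplacian of `log ‖Ω‖_ω` satisfies
`∇² log ‖Ω‖_ω = −(i∂∂̄ω)_α{}^{αμ}{}_μ + T_{αμν̄} T^{μν̄α} − T_α{}^{μα} ∂_μ log ‖Ω‖_ω
  + T_α{}^{μ̄α} ∂_{μ̄} log ‖Ω‖_ω`.

Formalised on the local model `ℂ³`, where `Ω = f dz¹²³` with `f` holomorphic and
nonvanishing, and `‖Ω‖_ω² = |f|² (det g_{μν̄})⁻¹`.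
-/
open scoped BigOperators

/-! ## The local model

`Pt = ℂ³` with its standard holomorphic coordinates is the local model of a complex
threefold.  Tensors are given by their components in the complexified coordinate frame:
the index type is `Ix = Fin 3 ⊕ Fin 3`, where `Sum.inl μ` is the holomorphic index `μ`
and `Sum.inr μ` is the antiholomorphic index `μ̄`.  A hermitian metric
`ω = i g_{μν̄} dz^μ ∧ dz̄^ν` is encoded by its components `g μ ν = g_{μν̄}` together with
the components `ginv α β = g^{αβ̄}` of the inverse metric.  Components of a `p`-form `Q`
follow the normalization `Q = (1/p!) Q_{m₁⋯m_p} dx^{m₁} ∧ ⋯ ∧ dx^{m_p}`.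
-/

/-- The local model of a complex threefold: `ℂ³`. -/
abbrev Pt : Type := EuclideanSpace ℂ (Fin 3)

/-- The holomorphic Wirtinger derivative `∂/∂z^μ`. -/
def Dh (μ : Fin 3) (f : Pt → ℂ) : Pt → ℂ := fun z =>
  (2⁻¹ : ℂ) * (fderiv ℝ f z (EuclideanSpace.single μ 1)
    - Complex.I * fderiv ℝ f z (EuclideanSpace.single μ Complex.I))

/-- The antiholomorphic Wirtinger derivative `∂/∂z̄^μ`. -/
def Da (μ : Fin 3) (f : Pt → ℂ) : Pt → ℂ := fun z =>
  (2⁻¹ : ℂ) * (fderiv ℝ f z (EuclideanSpace.single μ 1)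
    + Complex.I * fderiv ℝ f z (EuclideanSpace.single μ Complex.I))

/-- Complexified coordinate index: `inl μ ↦ z^μ`, `inr μ ↦ z̄^μ`. -/
abbrev Ix : Type := Fin 3 ⊕ Fin 3

/-- The partial derivative in the direction of a complexified index. -/
def DF : Ix → (Pt → ℂ) → (Pt → ℂ)
  | Sum.inl μ => Dh μ
  | Sum.inr μ => Da μ

/-- Number of holomorphic indices (`1` for `inl`, `0` for `inr`). -/
def nHol : Ix → ℕ
  | Sum.inl _ => 1
  | Sum.inr _ => 0

/-- Full components of the hermitian metric: `gF_{μν̄} = g_{μν̄}`, `gF_{ν̄μ} = g_{μν̄}`,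
and the pure components vanish. -/
def gF (g : Fin 3 → Fin 3 → Pt → ℂ) : Ix → Ix → Pt → ℂ
  | Sum.inl μ, Sum.inr ν => g μ ν
  | Sum.inr ν, Sum.inl μ => g μ ν
  | _, _ => 0

/-- Full components of the inverse metric. -/
def ginvF (ginv : Fin 3 → Fin 3 → Pt → ℂ) : Ix → Ix → Pt → ℂ
  | Sum.inl α, Sum.inr β => ginv α β
  | Sum.inr β, Sum.inl α => ginv α β
  | _, _ => 0

/-- Full components of the hermitian form `ω = i g_{μν̄} dz^μ ∧ dz̄^ν`. -/
def omF (g : Fin 3 → Fin 3 → Pt → ℂ) : Ix → Ix → Pt → ℂ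
  | Sum.inl μ, Sum.inr ν => fun z => Complex.I * g μ ν z
  | Sum.inr ν, Sum.inl μ => fun z => -(Complex.I * g μ ν z)
  | _, _ => 0

/-- Exterior derivative of a 2-form, in components. -/
def dTwo (η : Ix → Ix → Pt → ℂ) (a b c : Ix) : Pt → ℂ := fun z =>
  DF a (η b c) z - DF b (η a c) z + DF c (η a b) z

/-- Exterior derivative of a 3-form, in components. -/
def dThree (η : Ix → Ix → Ix → Pt → ℂ) (a b c d : Ix) : Pt → ℂ := fun z =>
  DF a (η b c d) z - DF b (η a c d) z + DF c (η a b d) z - DF d (η a b c) z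

/-- Exterior derivative of a 4-form, in components. -/
def dFour (η : Ix → Ix → Ix → Ix → Pt → ℂ) (a b c d e : Ix) : Pt → ℂ := fun z =>
  DF a (η b c d e) z - DF b (η a c d e) z + DF c (η a b d e) z
    - DF d (η a b c e) z + DF e (η a b c d) z

/-- The torsion 3-form `T = i(∂ − ∂̄)ω`:  on a complex manifold, the `(2,1)`
(resp. `(1,2)`) part of `dω` is obtained by restricting to index patterns with exactly
two (resp. one) holomorphic indices.  In particular
`T_{μνρ̄} = −∂_μ g_{νρ̄} + ∂_ν g_{μρ̄}`. -/
def TorF (g : Fin 3 → Fin 3 → Pt → ℂ) (a b c : Ix) : Pt → ℂ := fun z =>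
  Complex.I * ((if nHol a + nHol b + nHol c = 2 then (1:ℂ) else 0)
    - (if nHol a + nHol b + nHol c = 1 then (1:ℂ) else 0)) * dTwo (omF g) a b c z

/-- The `(1,2)` part `∂̄ω` of `dω`. -/
def pbarOm (g : Fin 3 → Fin 3 → Pt → ℂ) (a b c : Ix) : Pt → ℂ := fun z =>
  if nHol a + nHol b + nHol c = 1 then dTwo (omF g) a b c z else 0

/-- The `(2,2)`-form `i ∂∂̄ω`, obtained as `i` times the `(2,2)` part of `d(∂̄ω)`. -/
def iddbarOm (g : Fin 3 → Fin 3 → Pt → ℂ) (a b c d : Ix) : Pt → ℂ := fun z =>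
  Complex.I * (if nHol a + nHol b + nHol c + nHol d = 2
    then dThree (pbarOm g) a b c d z else 0)

/-- The trace `T_μ{}^μ{}_m = g^{μν̄} T_{μν̄m}` of the torsion. -/
def TrT (g ginv : Fin 3 → Fin 3 → Pt → ℂ) (m : Ix) : Pt → ℂ := fun z =>
  ∑ μ, ∑ ν, ginv μ ν z * TorF g (Sum.inl μ) (Sum.inr ν) m z

/-- Levi-Civita connection symbols of the full metric,
`Γ^a{}_{bc} = (1/2) g^{ad} (∂_b g_{dc} + ∂_c g_{db} − ∂_d g_{bc})`. -/
def GamLC (g ginv : Fin 3 → Fin 3 → Pt → ℂ) (a b c : Ix) : Pt → ℂ := fun z =>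
  (2⁻¹ : ℂ) * ∑ d, ginvF ginv a d z *
    (DF b (gF g d c) z + DF c (gF g d b) z - DF d (gF g b c) z)

/-- Riemann curvature of the Levi-Civita connection,
`R^{LC}{}_{mn}{}^a{}_b = ∂_m Γ^a{}_{nb} − ∂_n Γ^a{}_{mb} + Γ^a{}_{mc} Γ^c{}_{nb} − Γ^a{}_{nc} Γ^c{}_{mb}`. -/
def RLC (g ginv : Fin 3 → Fin 3 → Pt → ℂ) (m n a b : Ix) : Pt → ℂ := fun z =>
  DF m (GamLC g ginv a n b) z - DF n (GamLC g ginv a m b) z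
    + ∑ c, (GamLC g ginv a m c z * GamLC g ginv c n b z
      - GamLC g ginv a n c z * GamLC g ginv c m b z)

/-- Ricci curvature of the Levi-Civita connection, `Ric_{mn} = −R^{LC}{}_{mi}{}^i{}_n`. -/
def RicLC (g ginv : Fin 3 → Fin 3 → Pt → ℂ) (m n : Ix) : Pt → ℂ := fun z =>
  -∑ i, RLC g ginv m i i n z

/-- Components of the wedge product of two 2-forms. -/
def wedge22 (A B : Ix → Ix → Pt → ℂ) (a b c d : Ix) : Pt → ℂ := fun z =>
  A a b z * B c d z - A a c z * B b d z + A a d z * B b c z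
    + A c d z * B a b z - A b d z * B a c z + A b c z * B a d z

/-- `det (g_{μν̄})`. -/
def detg (g : Fin 3 → Fin 3 → Pt → ℂ) : Pt → ℂ := fun z =>
  Matrix.det (Matrix.of fun μ ν => g μ ν z)

/-- The norm `‖Ω‖_ω` of the holomorphic volume form `Ω = f dz¹²³`, where locally
`‖Ω‖_ω² = |f|² (det g_{μν̄})⁻¹`. -/
def nrmOm (g : Fin 3 → Fin 3 → Pt → ℂ) (f : Pt → ℂ) : Pt → ℝ := fun z =>
  Real.sqrt (Complex.normSq (f z) / (detg g z).re)

/-- The Levi-Civita Laplacian of a scalar,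
`∇²u = g^{ab}(∂_a ∂_b u − Γ^c{}_{ab} ∂_c u)`. -/
def LapLC (g ginv : Fin 3 → Fin 3 → Pt → ℂ) (u : Pt → ℂ) : Pt → ℂ := fun z =>
  ∑ a, ∑ b, ginvF ginv a b z *
    (DF a (DF b u) z - ∑ c, GamLC g ginv c a b z * DF c u z)

/-- The contraction `T_{αμν̄} T^{μν̄α}`. -/
def TTcon (g ginv : Fin 3 → Fin 3 → Pt → ℂ) : Pt → ℂ := fun z =>
  ∑ α, ∑ μ, ∑ ν, ∑ b, ∑ c, ∑ d,
    TorF g (Sum.inl α) (Sum.inl μ) (Sum.inr ν) z * ginv μ b z * ginv c ν z * ginv α d z *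
      TorF g (Sum.inr b) (Sum.inl c) (Sum.inr d) z

abbrev Sm (f : Pt → ℂ) : Prop := ContDiff ℝ (⊤ : ℕ∞) f

/-- real direction of an index -/
def e1 : Ix → Pt
  | Sum.inl μ => EuclideanSpace.single μ 1
  | Sum.inr μ => EuclideanSpace.single μ 1

def e2 : Ix → Pt
  | Sum.inl μ => EuclideanSpace.single μ Complex.I
  | Sum.inr μ => EuclideanSpace.single μ Complex.I

def sg : Ix → ℂ
  | Sum.inl _ => -Complex.I
  | Sum.inr _ => Complex.I

lemma DF_eq (a : Ix) (f : Pt → ℂ) (z : Pt) :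
    DF a f z = 2⁻¹ * (fderiv ℝ f z (e1 a) + sg a * fderiv ℝ f z (e2 a)) := by
  cases a <;> simp [DF, Dh, Da, e1, e2, sg, sub_eq_add_neg]

lemma Sm.da {f : Pt → ℂ} (hf : Sm f) (z : Pt) : DifferentiableAt ℝ f z :=
  (hf.differentiable (by simp)) z

lemma Sm.fd {f : Pt → ℂ} (hf : Sm f) (v : Pt) : Sm (fun z => fderiv ℝ f z v) :=
  (hf.fderiv_right (m := ((⊤ : ℕ∞) : WithTop ℕ∞)) (by simp)).clm_apply contDiff_const

lemma Sm.DF {f : Pt → ℂ} (hf : Sm f) (a : Ix) : Sm (DF a f) := by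
  have : _root_.DF a f = fun z => 2⁻¹ * (fderiv ℝ f z (e1 a) + sg a * fderiv ℝ f z (e2 a)) :=
    funext (DF_eq a f)
  rw [this]
  exact contDiff_const.mul ((hf.fd _).add (contDiff_const.mul (hf.fd _)))

lemma DF_add (a : Ix) {f h : Pt → ℂ} (hf : Sm f) (hh : Sm h) (z : Pt) :
    DF a (fun w => f w + h w) z = DF a f z + DF a h z := by
  simp only [DF_eq, fderiv_fun_add (hf.da z) (hh.da z), _root_.add_apply]; ring

lemma DF_sub (a : Ix) {f h : Pt → ℂ} (hf : Sm f) (hh : Sm h) (z : Pt) :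
    DF a (fun w => f w - h w) z = DF a f z - DF a h z := by
  simp only [DF_eq, fderiv_fun_sub (hf.da z) (hh.da z), _root_.sub_apply]; ring

lemma DF_mul (a : Ix) {f h : Pt → ℂ} (hf : Sm f) (hh : Sm h) (z : Pt) :
    DF a (fun w => f w * h w) z = DF a f z * h z + f z * DF a h z := by
  simp only [DF_eq, fderiv_fun_mul (hf.da z) (hh.da z), _root_.add_apply,
    _root_.smul_apply, smul_eq_mul]; ring

lemma DF_const (a : Ix) (c : ℂ) (z : Pt) : DF a (fun _ => c) z = 0 := by
  simp [DF_eq]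

lemma DF_zero (a : Ix) (z : Pt) : DF a 0 z = 0 := DF_const a 0 z

lemma DF_cmul (a : Ix) (c : ℂ) {f : Pt → ℂ} (hf : Sm f) (z : Pt) :
    DF a (fun w => c * f w) z = c * DF a f z := by
  rw [DF_mul a contDiff_const hf, DF_const]; ring

lemma DF_neg (a : Ix) {f : Pt → ℂ} (z : Pt) :
    DF a (fun w => - f w) z = - DF a f z := by
  simp only [DF_eq, fderiv_fun_neg, _root_.neg_apply]; ring

lemma DF_sum (a : Ix) {f : Fin 3 → Pt → ℂ} (hf : ∀ i, Sm (f i)) (z : Pt) :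
    DF a (fun w => ∑ i, f i w) z = ∑ i, DF a (f i) z := by
  simp only [Fin.sum_univ_three]
  rw [DF_add a ((hf 0).add (hf 1)) (hf 2), DF_add a (hf 0) (hf 1)]

lemma DF_exp (a : Ix) {u : Pt → ℂ} (hu : Sm u) (z : Pt) :
    DF a (fun w => Complex.exp (u w)) z = Complex.exp (u z) * DF a u z := by
  have := ((hu.da z).hasFDerivAt.cexp).fderiv
  simp only [DF_eq, this, _root_.smul_apply, smul_eq_mul]; ring

lemma fd_symm {f : Pt → ℂ} (hf : Sm f) (z v w : Pt) :
    fderiv ℝ (fun y => fderiv ℝ f y v) z w = fderiv ℝ (fun y => fderiv ℝ f y w) z v := by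
  have h2 : DifferentiableAt ℝ (fderiv ℝ f) z :=
    ((hf.fderiv_right (m := 1) (by norm_cast)).differentiable (by simp)) z
  have hs : IsSymmSndFDerivAt ℝ f z := hf.contDiffAt.isSymmSndFDerivAt (by
    simp only [minSmoothness_of_isRCLikeNormedField]; norm_cast)
  have key : ∀ x y : Pt, fderiv ℝ (fun y => fderiv ℝ f y x) z y = fderiv ℝ (fderiv ℝ f) z y x := by
    intro x y
    rw [fderiv_clm_apply h2 (differentiableAt_const x)]
    simp
  rw [key, key]
  exact hs w v

lemma fd_DF {f : Pt → ℂ} (hf : Sm f) (a : Ix) (z v : Pt) :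
    fderiv ℝ (DF a f) z v = 2⁻¹ * (fderiv ℝ (fun y => fderiv ℝ f y (e1 a)) z v
      + sg a * fderiv ℝ (fun y => fderiv ℝ f y (e2 a)) z v) := by
  have : _root_.DF a f = fun z => 2⁻¹ * (fderiv ℝ f z (e1 a) + sg a * fderiv ℝ f z (e2 a)) :=
    funext (DF_eq a f)
  have h1 := (hf.fd (e1 a)).da z
  have h2 := (hf.fd (e2 a)).da z
  rw [this, fderiv_const_mul (h1.fun_add (h2.const_mul _)), fderiv_fun_add h1 (h2.const_mul _),
    fderiv_const_mul h2]
  simp [mul_add]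

lemma DF_comm {f : Pt → ℂ} (hf : Sm f) (a b : Ix) (z : Pt) :
    DF a (DF b f) z = DF b (DF a f) z := by
  rw [DF_eq, DF_eq]
  simp only [fd_DF hf]
  rw [fd_symm hf z (e1 b) (e1 a), fd_symm hf z (e1 b) (e2 a), fd_symm hf z (e2 b) (e1 a),
    fd_symm hf z (e2 b) (e2 a)]
  ring

lemma Dh_conj (μ : Fin 3) {f : Pt → ℂ} (hf : Sm f) (z : Pt) :
    Dh μ (fun w => (starRingEnd ℂ) (f w)) z = (starRingEnd ℂ) (Da μ f z) := by
  have : fderiv ℝ (fun w => (starRingEnd ℂ) (f w)) z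
      = (Complex.conjCLE : ℂ →L[ℝ] ℂ).comp (fderiv ℝ f z) :=
    ((Complex.conjCLE : ℂ →L[ℝ] ℂ).hasFDerivAt.comp z (hf.da z).hasFDerivAt).fderiv
  simp only [Dh, Da, this]
  simp [Complex.conj_ofNat, sub_eq_add_neg]

lemma Sm.conj {f : Pt → ℂ} (hf : Sm f) : Sm (fun w => (starRingEnd ℂ) (f w)) :=
  (Complex.conjCLE : ℂ →L[ℝ] ℂ).contDiff.comp hf

open scoped ComplexOrder in
/-- positivity of the determinant -/
lemma det_pos' (g : Fin 3 → Fin 3 → Pt → ℂ)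
    (hherm : ∀ μ ν z, (starRingEnd ℂ) (g μ ν z) = g ν μ z)
    (hpos : ∀ z (v : Fin 3 → ℂ), v ≠ 0 →
      0 < (∑ μ, ∑ ν, g μ ν z * v μ * (starRingEnd ℂ) (v ν)).re) (z : Pt) :
    0 < (detg g z).re ∧ (detg g z) = ((detg g z).re : ℂ) := by
  have hH : (Matrix.of fun μ ν => g ν μ z).IsHermitian := by
    ext i j; simp [hherm]
  have hP : (Matrix.of fun μ ν => g ν μ z).PosDef := by
    refine Matrix.PosDef.of_dotProduct_mulVec_pos hH ?_
    intro v hv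
    have h1 := hpos z v hv
    have e : star v ⬝ᵥ (Matrix.of fun μ ν => g ν μ z).mulVec v
        = ∑ μ, ∑ ν, g μ ν z * v μ * (starRingEnd ℂ) (v ν) := by
      simp [dotProduct, Matrix.mulVec, Fin.sum_univ_three]; ring
    rw [e]
    rw [Complex.lt_def]
    refine ⟨by simpa using h1, ?_⟩
    have hc : (starRingEnd ℂ) (∑ μ, ∑ ν, g μ ν z * v μ * (starRingEnd ℂ) (v ν))
      = ∑ μ, ∑ ν, g μ ν z * v μ * (starRingEnd ℂ) (v ν) := by
      simp [hherm, Fin.sum_univ_three]; ring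
    have := Complex.conj_eq_iff_im.1 hc
    simpa using this.symm
  have hd := hP.det_pos
  have e : (Matrix.of fun μ ν => g ν μ z).det = detg g z := by
    rw [detg, ← Matrix.det_transpose]; rfl
  rw [e, Complex.lt_def] at hd
  refine ⟨by simpa using hd.1, ?_⟩
  apply Complex.ext <;> simp
  simpa using hd.2.symm

lemma cof_eq (g ginv : Fin 3 → Fin 3 → Pt → ℂ)
    (hinv1 : ∀ z α β, ∑ σ, ginv α σ z * g β σ z = (if α = β then (1:ℂ) else 0))
    (z : Pt) (a r : Fin 3) :
    detg g z * ginv a r z = g (a+1) (r+1) z * g (a+2) (r+2) z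
      - g (a+1) (r+2) z * g (a+2) (r+1) z := by
  set M : Matrix (Fin 3) (Fin 3) ℂ := Matrix.of fun i j => g j i z with hM
  set H : Matrix (Fin 3) (Fin 3) ℂ := Matrix.of fun i j => ginv i j z with hH
  have h1 : H * M = 1 := by
    ext i j
    simp [Matrix.mul_apply, Matrix.one_apply, hM, hH, hinv1]
  have hd : M.det = detg g z := by
    rw [detg, ← Matrix.det_transpose]; rfl
  have h2 : M.det • H = M.adjugate := by
    calc M.det • H = H * (M * M.adjugate) := by rw [Matrix.mul_adjugate]; simp
      _ = M.adjugate := by rw [← Matrix.mul_assoc, h1, Matrix.one_mul]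
  have h3 := congrFun (congrFun h2 a) r
  rw [hd] at h3
  have h4 : detg g z * ginv a r z = M.adjugate a r := by rw [← h3]; simp [hH]
  rw [h4, Matrix.adjugate_fin_three]
  fin_cases a <;> fin_cases r <;> simp [hM] <;> ring

lemma Sm.detg {g : Fin 3 → Fin 3 → Pt → ℂ} (hg : ∀ μ ν, Sm (g μ ν)) : Sm (detg g) := by
  have : _root_.detg g = fun z => g 0 0 z * g 1 1 z * g 2 2 z - g 0 0 z * g 1 2 z * g 2 1 z
      - g 0 1 z * g 1 0 z * g 2 2 z + g 0 1 z * g 1 2 z * g 2 0 z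
      + g 0 2 z * g 1 0 z * g 2 1 z - g 0 2 z * g 1 1 z * g 2 0 z := by
    funext z; simp [_root_.detg, Matrix.det_fin_three]
  rw [this]
  have h := hg
  unfold Sm at *
  fun_prop

/-- logarithmic derivative of the determinant -/
def Lf (g ginv : Fin 3 → Fin 3 → Pt → ℂ) (a : Ix) : Pt → ℂ := fun z =>
  ∑ ν, ∑ ρ, ginv ν ρ z * DF a (g ν ρ) z

lemma DF_mul3 (a : Ix) {f h k : Pt → ℂ} (hf : Sm f) (hh : Sm h) (hk : Sm k) (z : Pt) :
    DF a (fun w => f w * h w * k w) z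
      = DF a f z * h z * k z + f z * DF a h z * k z + f z * h z * DF a k z := by
  rw [DF_mul a (hf.mul hh) hk, DF_mul a hf hh]; ring

lemma DF_det (g ginv : Fin 3 → Fin 3 → Pt → ℂ) (hg : ∀ μ ν, Sm (g μ ν))
    (hinv1 : ∀ z α β, ∑ σ, ginv α σ z * g β σ z = (if α = β then (1:ℂ) else 0))
    (z : Pt) (a : Ix) : DF a (detg g) z = detg g z * Lf g ginv a z := by
  have e : _root_.detg g = fun z => g 0 0 z * g 1 1 z * g 2 2 z - g 0 0 z * g 1 2 z * g 2 1 z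
      - g 0 1 z * g 1 0 z * g 2 2 z + g 0 1 z * g 1 2 z * g 2 0 z
      + g 0 2 z * g 1 0 z * g 2 1 z - g 0 2 z * g 1 1 z * g 2 0 z := by
    funext z; simp [_root_.detg, Matrix.det_fin_three]
  have s3 : ∀ i j k l m n, Sm (fun z => g i j z * g k l z * g m n z) := fun i j k l m n =>
    ((hg i j).mul (hg k l)).mul (hg m n)
  have lhs : DF a (detg g) z = ∑ ν, ∑ ρ, (g (ν+1) (ρ+1) z * g (ν+2) (ρ+2) z
      - g (ν+1) (ρ+2) z * g (ν+2) (ρ+1) z) * DF a (g ν ρ) z := by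
    rw [e, DF_sub a (((((s3 _ _ _ _ _ _).sub (s3 _ _ _ _ _ _)).sub (s3 _ _ _ _ _ _)).add
        (s3 _ _ _ _ _ _)).add (s3 _ _ _ _ _ _)) (s3 _ _ _ _ _ _),
      DF_add a ((((s3 _ _ _ _ _ _).sub (s3 _ _ _ _ _ _)).sub (s3 _ _ _ _ _ _)).add
        (s3 _ _ _ _ _ _)) (s3 _ _ _ _ _ _),
      DF_add a (((s3 _ _ _ _ _ _).sub (s3 _ _ _ _ _ _)).sub (s3 _ _ _ _ _ _))
        (s3 _ _ _ _ _ _),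
      DF_sub a ((s3 _ _ _ _ _ _).sub (s3 _ _ _ _ _ _)) (s3 _ _ _ _ _ _),
      DF_sub a (s3 _ _ _ _ _ _) (s3 _ _ _ _ _ _)]
    simp only [DF_mul3 a (hg _ _) (hg _ _) (hg _ _), Fin.sum_univ_three]
    have h11 : (1:Fin 3) + 1 = 2 := rfl
    have h12 : (1:Fin 3) + 2 = 0 := rfl
    have h21 : (2:Fin 3) + 1 = 0 := rfl
    have h22 : (2:Fin 3) + 2 = 1 := rfl
    simp only [zero_add, h11, h12, h21, h22]
    ring
  rw [lhs, Lf, Finset.mul_sum]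
  refine Finset.sum_congr rfl fun ν _ => ?_
  rw [Finset.mul_sum]
  refine Finset.sum_congr rfl fun ρ _ => ?_
  rw [← cof_eq g ginv hinv1, mul_assoc]

lemma Dinv1 (g ginv : Fin 3 → Fin 3 → Pt → ℂ) (hg : ∀ μ ν, Sm (g μ ν)) (hG : ∀ μ ν, Sm (ginv μ ν))
    (hinv1 : ∀ z α β, ∑ σ, ginv α σ z * g β σ z = (if α = β then (1:ℂ) else 0))
    (z : Pt) (a : Ix) (α β : Fin 3) :
    ∑ σ, (DF a (ginv α σ) z * g β σ z + ginv α σ z * DF a (g β σ) z) = 0 := by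
  have h : (fun w => ∑ σ, ginv α σ w * g β σ w) = fun _ => (if α = β then (1:ℂ) else 0) :=
    funext fun w => hinv1 w α β
  have h2 := DF_const a (if α = β then (1:ℂ) else 0) z
  rw [← h, DF_sum a (fun σ => (hG α σ).mul (hg β σ))] at h2
  rw [← h2]
  exact Finset.sum_congr rfl fun σ _ => (DF_mul a (hG α σ) (hg β σ) z).symm

lemma Dinv2 (g ginv : Fin 3 → Fin 3 → Pt → ℂ) (hg : ∀ μ ν, Sm (g μ ν)) (hG : ∀ μ ν, Sm (ginv μ ν))
    (hinv2 : ∀ z σ τ, ∑ α, ginv α σ z * g α τ z = (if σ = τ then (1:ℂ) else 0))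
    (z : Pt) (a : Ix) (σ τ : Fin 3) :
    ∑ α, (DF a (ginv α σ) z * g α τ z + ginv α σ z * DF a (g α τ) z) = 0 := by
  have h : (fun w => ∑ α, ginv α σ w * g α τ w) = fun _ => (if σ = τ then (1:ℂ) else 0) :=
    funext fun w => hinv2 w σ τ
  have h2 := DF_const a (if σ = τ then (1:ℂ) else 0) z
  rw [← h, DF_sum a (fun α => (hG α σ).mul (hg α τ))] at h2
  rw [← h2]
  exact Finset.sum_congr rfl fun α _ => (DF_mul a (hG α σ) (hg α τ) z).symm

lemma Dginv (g ginv : Fin 3 → Fin 3 → Pt → ℂ) (hg : ∀ μ ν, Sm (g μ ν)) (hG : ∀ μ ν, Sm (ginv μ ν))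
    (hinv1 : ∀ z α β, ∑ σ, ginv α σ z * g β σ z = (if α = β then (1:ℂ) else 0))
    (hinv2 : ∀ z σ τ, ∑ α, ginv α σ z * g α τ z = (if σ = τ then (1:ℂ) else 0))
    (z : Pt) (a : Ix) (ν ρ : Fin 3) :
    DF a (ginv ν ρ) z = - ∑ α, ∑ β, ginv ν β z * DF a (g α β) z * ginv α ρ z := by
  have h1 := Dinv1 g ginv hg hG hinv1 z a ν
  have h2 : ∑ β, (∑ σ, (DF a (ginv ν σ) z * g β σ z + ginv ν σ z * DF a (g β σ) z)) * ginv β ρ z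
      = 0 := by simp [h1]
  have h3 : ∑ σ, DF a (ginv ν σ) z * ∑ β, ginv β ρ z * g β σ z = DF a (ginv ν ρ) z := by
    simp [hinv2]
  simp only [Fin.sum_univ_three] at h2 h3 ⊢
  linear_combination h2 - h3

lemma wedge_eq (g : Fin 3 → Fin 3 → Pt → ℂ) (b c p q : Fin 3) (z : Pt) :
    wedge22 (omF g) (omF g) (Sum.inl b) (Sum.inl c) (Sum.inr p) (Sum.inr q) z
      = 2 * (g b p z * g c q z - g b q z * g c p z) := by
  simp only [wedge22, omF, Pi.zero_apply]
  linear_combination (-2 * (g b p z * g c q z - g b q z * g c p z)) * Complex.I_sq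

lemma wedge_zero1 (g : Fin 3 → Fin 3 → Pt → ℂ) (b c p q : Fin 3) (z : Pt) :
    wedge22 (omF g) (omF g) (Sum.inl b) (Sum.inl c) (Sum.inl p) (Sum.inr q) z = 0 := by
  simp [wedge22, omF]

lemma wedge_zero2 (g : Fin 3 → Fin 3 → Pt → ℂ) (b c p q : Fin 3) (z : Pt) :
    wedge22 (omF g) (omF g) (Sum.inl b) (Sum.inr c) (Sum.inr p) (Sum.inr q) z = 0 := by
  simp [wedge22, omF]

lemma bal_h (g ginv : Fin 3 → Fin 3 → Pt → ℂ) (N : Pt → ℂ) (hN : Sm N) (hg : ∀ μ ν, Sm (g μ ν))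
    (hG : ∀ μ ν, Sm (ginv μ ν))
    (hinv1 : ∀ z α β, ∑ σ, ginv α σ z * g β σ z = (if α = β then (1:ℂ) else 0))
    (hbal : ∀ (a b c d e : Ix) (z : Pt),
      dFour (fun a' b' c' d' w =>
        N w * wedge22 (omF g) (omF g) a' b' c' d' w) a b c d e z = 0) (z : Pt) (r : Fin 3) :
    ∑ a, DF (Sum.inl a) (fun w => N w * (detg g w * ginv a r w)) z = 0 := by
  have h := hbal (Sum.inl 0) (Sum.inl 1) (Sum.inl 2) (Sum.inr (r+1)) (Sum.inr (r+2)) z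
  have s : ∀ a r, Sm (fun w => N w * (detg g w * ginv a r w)) := fun a r =>
    hN.mul ((Sm.detg hg).mul (hG a r))
  have e0 : (fun w => N w * wedge22 (omF g) (omF g) (Sum.inl 1) (Sum.inl 2) (Sum.inr (r+1))
      (Sum.inr (r+2)) w) = fun w => 2 * (N w * (detg g w * ginv 0 r w)) := by
    funext w; rw [wedge_eq, cof_eq g ginv hinv1]; simp only [zero_add]; ring
  have e1 : (fun w => N w * wedge22 (omF g) (omF g) (Sum.inl 0) (Sum.inl 2) (Sum.inr (r+1))
      (Sum.inr (r+2)) w) = fun w => (-2) * (N w * (detg g w * ginv 1 r w)) := by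
    funext w; rw [wedge_eq, cof_eq g ginv hinv1]
    rw [show (1:Fin 3) + 1 = 2 from rfl, show (1:Fin 3) + 2 = 0 from rfl]; ring
  have e2 : (fun w => N w * wedge22 (omF g) (omF g) (Sum.inl 0) (Sum.inl 1) (Sum.inr (r+1))
      (Sum.inr (r+2)) w) = fun w => 2 * (N w * (detg g w * ginv 2 r w)) := by
    funext w; rw [wedge_eq, cof_eq g ginv hinv1]
    rw [show (2:Fin 3) + 1 = 0 from rfl, show (2:Fin 3) + 2 = 1 from rfl]; ring
  simp only [dFour, e0, e1, e2, wedge_zero1, mul_zero, DF_const] at h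
  rw [DF_cmul _ _ (s 0 r), DF_cmul _ _ (s 1 r), DF_cmul _ _ (s 2 r)] at h
  rw [Fin.sum_univ_three]
  linear_combination h / 2

lemma bal_a (g ginv : Fin 3 → Fin 3 → Pt → ℂ) (N : Pt → ℂ) (hN : Sm N) (hg : ∀ μ ν, Sm (g μ ν))
    (hG : ∀ μ ν, Sm (ginv μ ν))
    (hinv1 : ∀ z α β, ∑ σ, ginv α σ z * g β σ z = (if α = β then (1:ℂ) else 0))
    (hbal : ∀ (a b c d e : Ix) (z : Pt),
      dFour (fun a' b' c' d' w =>
        N w * wedge22 (omF g) (omF g) a' b' c' d' w) a b c d e z = 0) (z : Pt) (r : Fin 3) :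
    ∑ a, DF (Sum.inr a) (fun w => N w * (detg g w * ginv r a w)) z = 0 := by
  have h := hbal (Sum.inl (r+1)) (Sum.inl (r+2)) (Sum.inr 0) (Sum.inr 1) (Sum.inr 2) z
  have s : ∀ a r, Sm (fun w => N w * (detg g w * ginv a r w)) := fun a r =>
    hN.mul ((Sm.detg hg).mul (hG a r))
  have e0 : (fun w => N w * wedge22 (omF g) (omF g) (Sum.inl (r+1)) (Sum.inl (r+2)) (Sum.inr 1)
      (Sum.inr 2) w) = fun w => 2 * (N w * (detg g w * ginv r 0 w)) := by
    funext w; rw [wedge_eq, cof_eq g ginv hinv1]; simp only [zero_add]; ring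
  have e1 : (fun w => N w * wedge22 (omF g) (omF g) (Sum.inl (r+1)) (Sum.inl (r+2)) (Sum.inr 0)
      (Sum.inr 2) w) = fun w => (-2) * (N w * (detg g w * ginv r 1 w)) := by
    funext w; rw [wedge_eq, cof_eq g ginv hinv1]
    rw [show (1:Fin 3) + 1 = 2 from rfl, show (1:Fin 3) + 2 = 0 from rfl]; ring
  have e2 : (fun w => N w * wedge22 (omF g) (omF g) (Sum.inl (r+1)) (Sum.inl (r+2)) (Sum.inr 0)
      (Sum.inr 1) w) = fun w => 2 * (N w * (detg g w * ginv r 2 w)) := by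
    funext w; rw [wedge_eq, cof_eq g ginv hinv1]
    rw [show (2:Fin 3) + 1 = 0 from rfl, show (2:Fin 3) + 2 = 1 from rfl]; ring
  simp only [dFour, e0, e1, e2, wedge_zero2, mul_zero, DF_const] at h
  rw [DF_cmul _ _ (s r 0), DF_cmul _ _ (s r 1), DF_cmul _ _ (s r 2)] at h
  rw [Fin.sum_univ_three]
  linear_combination h / 2

def Mh (g ginv : Fin 3 → Fin 3 → Pt → ℂ) (μ : Fin 3) : Pt → ℂ := fun z =>
  ∑ ν, ∑ ρ, ginv ν ρ z * DF (Sum.inl ν) (g μ ρ) z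

def Ma (g ginv : Fin 3 → Fin 3 → Pt → ℂ) (σ : Fin 3) : Pt → ℂ := fun z =>
  ∑ ν, ∑ ρ, ginv ν ρ z * DF (Sum.inr ρ) (g ν σ) z

lemma DF_NdG (g ginv : Fin 3 → Fin 3 → Pt → ℂ) (u : Pt → ℂ) (hu : Sm u) (hg : ∀ μ ν, Sm (g μ ν))
    (hG : ∀ μ ν, Sm (ginv μ ν))
    (hinv1 : ∀ z α β, ∑ σ, ginv α σ z * g β σ z = (if α = β then (1:ℂ) else 0))
    (z : Pt) (d : Ix) (a r : Fin 3) :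
    DF d (fun w => Complex.exp (u w) * (detg g w * ginv a r w)) z
      = Complex.exp (u z) * detg g z * (DF d u z * ginv a r z + Lf g ginv d z * ginv a r z
        + DF d (ginv a r) z) := by
  rw [DF_mul d (f := fun w => Complex.exp (u w)) (Complex.contDiff_exp.comp hu) ((Sm.detg hg).mul (hG a r)),
    DF_mul d (Sm.detg hg) (hG a r), DF_exp d hu, DF_det g ginv hg hinv1]
  ring

lemma tau_h (g ginv : Fin 3 → Fin 3 → Pt → ℂ) (u : Pt → ℂ) (hu : Sm u) (hg : ∀ μ ν, Sm (g μ ν))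
    (hG : ∀ μ ν, Sm (ginv μ ν)) (hd : ∀ z, detg g z ≠ 0)
    (hinv1 : ∀ z α β, ∑ σ, ginv α σ z * g β σ z = (if α = β then (1:ℂ) else 0))
    (hbal : ∀ (a b c d e : Ix) (z : Pt),
      dFour (fun a' b' c' d' w =>
        Complex.exp (u w) * wedge22 (omF g) (omF g) a' b' c' d' w) a b c d e z = 0)
    (z : Pt) (μ : Fin 3) :
    DF (Sum.inl μ) u z + Lf g ginv (Sum.inl μ) z - Mh g ginv μ z = 0 := by
  have hb : ∀ r, ∑ a, (DF (Sum.inl a) u z * ginv a r z + Lf g ginv (Sum.inl a) z * ginv a r z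
        + DF (Sum.inl a) (ginv a r) z) = 0 := by
    intro r
    have h := bal_h g ginv (fun w => Complex.exp (u w)) (Complex.contDiff_exp.comp hu) hg hG hinv1
      hbal z r
    simp only [DF_NdG g ginv u hu hg hG hinv1] at h
    rw [← Finset.mul_sum] at h
    exact (mul_eq_zero.1 h).resolve_left (mul_ne_zero (Complex.exp_ne_zero _) (hd z))
  have h2 : ∑ r, g μ r z * ∑ a, (DF (Sum.inl a) u z * ginv a r z
      + Lf g ginv (Sum.inl a) z * ginv a r z + DF (Sum.inl a) (ginv a r) z) = 0 := by simp [hb]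
  have h3 : ∑ a, (DF (Sum.inl a) u z + Lf g ginv (Sum.inl a) z) * ∑ r, ginv a r z * g μ r z
      = DF (Sum.inl μ) u z + Lf g ginv (Sum.inl μ) z := by simp [hinv1]
  have h4 : ∑ a, ∑ r, (DF (Sum.inl a) (ginv a r) z * g μ r z
      + ginv a r z * DF (Sum.inl a) (g μ r) z) = 0 := by
    simp [Dinv1 g ginv hg hG hinv1]
  simp only [Mh, Fin.sum_univ_three] at h2 h3 h4 ⊢
  linear_combination h2 - h3 - h4

lemma tau_a (g ginv : Fin 3 → Fin 3 → Pt → ℂ) (u : Pt → ℂ) (hu : Sm u) (hg : ∀ μ ν, Sm (g μ ν))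
    (hG : ∀ μ ν, Sm (ginv μ ν)) (hd : ∀ z, detg g z ≠ 0)
    (hinv1 : ∀ z α β, ∑ σ, ginv α σ z * g β σ z = (if α = β then (1:ℂ) else 0))
    (hinv2 : ∀ z σ τ, ∑ α, ginv α σ z * g α τ z = (if σ = τ then (1:ℂ) else 0))
    (hbal : ∀ (a b c d e : Ix) (z : Pt),
      dFour (fun a' b' c' d' w =>
        Complex.exp (u w) * wedge22 (omF g) (omF g) a' b' c' d' w) a b c d e z = 0)
    (z : Pt) (σ : Fin 3) :
    DF (Sum.inr σ) u z + Lf g ginv (Sum.inr σ) z - Ma g ginv σ z = 0 := by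
  have hb : ∀ r, ∑ a, (DF (Sum.inr a) u z * ginv r a z + Lf g ginv (Sum.inr a) z * ginv r a z
        + DF (Sum.inr a) (ginv r a) z) = 0 := by
    intro r
    have h := bal_a g ginv (fun w => Complex.exp (u w)) (Complex.contDiff_exp.comp hu) hg hG hinv1
      hbal z r
    simp only [DF_NdG g ginv u hu hg hG hinv1] at h
    rw [← Finset.mul_sum] at h
    exact (mul_eq_zero.1 h).resolve_left (mul_ne_zero (Complex.exp_ne_zero _) (hd z))
  have h2 : ∑ r, g r σ z * ∑ a, (DF (Sum.inr a) u z * ginv r a z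
      + Lf g ginv (Sum.inr a) z * ginv r a z + DF (Sum.inr a) (ginv r a) z) = 0 := by simp [hb]
  have h3 : ∑ a, (DF (Sum.inr a) u z + Lf g ginv (Sum.inr a) z) * ∑ r, ginv r a z * g r σ z
      = DF (Sum.inr σ) u z + Lf g ginv (Sum.inr σ) z := by simp [hinv2]
  have h4 : ∑ a, ∑ r, (DF (Sum.inr a) (ginv r a) z * g r σ z
      + ginv r a z * DF (Sum.inr a) (g r σ) z) = 0 := by
    simp [Dinv2 g ginv hg hG hinv2]
  simp only [Ma, Fin.sum_univ_three] at h2 h3 h4 ⊢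
  linear_combination h2 - h3 - h4

lemma Lf_sm (g ginv : Fin 3 → Fin 3 → Pt → ℂ) (hg : ∀ μ ν, Sm (g μ ν))
    (hG : ∀ μ ν, Sm (ginv μ ν)) (a : Ix) : Sm (Lf g ginv a) :=
  ContDiff.sum fun ν _ => ContDiff.sum fun ρ _ => (hG ν ρ).mul ((hg ν ρ).DF a)

lemma Mh_sm (g ginv : Fin 3 → Fin 3 → Pt → ℂ) (hg : ∀ μ ν, Sm (g μ ν))
    (hG : ∀ μ ν, Sm (ginv μ ν)) (μ : Fin 3) : Sm (Mh g ginv μ) :=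
  ContDiff.sum fun ν _ => ContDiff.sum fun ρ _ => (hG ν ρ).mul ((hg μ ρ).DF _)

lemma DF_sum2 (a : Ix) {f h : Fin 3 → Fin 3 → Pt → ℂ} (hf : ∀ i j, Sm (f i j))
    (hh : ∀ i j, Sm (h i j)) (z : Pt) :
    DF a (fun w => ∑ i, ∑ j, f i j w * h i j w) z
      = ∑ i, ∑ j, (DF a (f i j) z * h i j z + f i j z * DF a (h i j) z) := by
  rw [DF_sum a (f := fun i w => ∑ j, f i j w * h i j w)
    (fun i => ContDiff.sum fun j _ => (hf i j).mul (hh i j))]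
  refine Finset.sum_congr rfl fun i _ => ?_
  rw [DF_sum a (f := fun j w => f i j w * h i j w) (fun j => (hf i j).mul (hh i j))]
  exact Finset.sum_congr rfl fun j _ => DF_mul a (hf i j) (hh i j) z

/-- the key second-order identity coming from holomorphy -/
lemma hol_key (g ginv : Fin 3 → Fin 3 → Pt → ℂ) (u f : Pt → ℂ) (hu : Sm u) (hg : ∀ μ ν, Sm (g μ ν))
    (hG : ∀ μ ν, Sm (ginv μ ν)) (hd : ∀ z, detg g z ≠ 0)
    (hinv1 : ∀ z α β, ∑ σ, ginv α σ z * g β σ z = (if α = β then (1:ℂ) else 0))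
    (hf : Sm f) (hfhol : ∀ μ z, Da μ f z = 0) (hfne : ∀ z, f z ≠ 0)
    (hN : ∀ z, Complex.exp (u z) * Complex.exp (u z) * detg g z = f z * (starRingEnd ℂ) (f z))
    (z : Pt) (σ μ : Fin 3) :
    2 * DF (Sum.inr σ) (DF (Sum.inl μ) u) z + DF (Sum.inr σ) (Lf g ginv (Sum.inl μ)) z = 0 := by
  have he : Sm (fun w => Complex.exp (u w)) := Complex.contDiff_exp.comp hu
  have h1 : ∀ w, (2 * DF (Sum.inl μ) u w + Lf g ginv (Sum.inl μ) w) * f w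
      = DF (Sum.inl μ) f w := by
    intro w
    have a1 : DF (Sum.inl μ) (fun z => Complex.exp (u z) * Complex.exp (u z) * detg g z) w
      = DF (Sum.inl μ) (fun z => f z * (starRingEnd ℂ) (f z)) w := by rw [funext hN]
    have a2 : DF (Sum.inl μ) (fun z => (starRingEnd ℂ) (f z)) w = 0 := by
      change Dh μ _ w = 0
      rw [Dh_conj μ hf, hfhol]; simp
    rw [DF_mul3 _ he he (Sm.detg hg), DF_mul _ hf hf.conj, DF_exp _ hu, DF_det g ginv hg hinv1, a2]
      at a1
    have hne : Complex.exp (u w) * Complex.exp (u w) * detg g w ≠ 0 :=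
      mul_ne_zero (mul_ne_zero (Complex.exp_ne_zero _) (Complex.exp_ne_zero _)) (hd w)
    apply mul_left_cancel₀ hne
    linear_combination f w * a1 - DF (Sum.inl μ) f w * hN w
  have s1 : Sm (fun w => 2 * DF (Sum.inl μ) u w + Lf g ginv (Sum.inl μ) w) :=
    (contDiff_const.mul (hu.DF _)).add (Lf_sm g ginv hg hG _)
  have h2 : DF (Sum.inr σ) (DF (Sum.inl μ) f) z = 0 := by
    rw [DF_comm hf]
    have : DF (Sum.inr σ) f = fun _ => 0 := funext (hfhol σ)
    rw [this, DF_const]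
  rw [← funext h1, DF_mul _ s1 hf, show DF (Sum.inr σ) f z = 0 from hfhol σ z, mul_zero, add_zero,
    DF_add _ (contDiff_const.mul (hu.DF _)) (Lf_sm g ginv hg hG _), DF_cmul _ _ (hu.DF _)] at h2
  exact (mul_eq_zero.1 h2).resolve_right (hfne z)

lemma omF_lr (g : Fin 3 → Fin 3 → Pt → ℂ) (hg : ∀ μ ν, Sm (g μ ν)) (d : Ix) (a b : Fin 3) (z : Pt) :
    DF d (omF g (Sum.inl a) (Sum.inr b)) z = Complex.I * DF d (g a b) z :=
  DF_cmul d _ (hg a b) z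

lemma omF_rl (g : Fin 3 → Fin 3 → Pt → ℂ) (hg : ∀ μ ν, Sm (g μ ν)) (d : Ix) (a b : Fin 3) (z : Pt) :
    DF d (omF g (Sum.inr b) (Sum.inl a)) z = -(Complex.I * DF d (g a b) z) := by
  rw [← DF_cmul d _ (hg a b) z]; exact DF_neg d z

lemma omF_ll (g : Fin 3 → Fin 3 → Pt → ℂ) (d : Ix) (a b : Fin 3) (z : Pt) :
    DF d (omF g (Sum.inl a) (Sum.inl b)) z = 0 := DF_zero d z

lemma omF_rr (g : Fin 3 → Fin 3 → Pt → ℂ) (d : Ix) (a b : Fin 3) (z : Pt) :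
    DF d (omF g (Sum.inr a) (Sum.inr b)) z = 0 := DF_zero d z

lemma Tor_llr (g : Fin 3 → Fin 3 → Pt → ℂ) (hg : ∀ μ ν, Sm (g μ ν)) (α μ ν : Fin 3) (z : Pt) :
    TorF g (Sum.inl α) (Sum.inl μ) (Sum.inr ν) z
      = DF (Sum.inl μ) (g α ν) z - DF (Sum.inl α) (g μ ν) z := by
  simp only [TorF, dTwo, nHol, omF_lr g hg, omF_ll]
  norm_num
  linear_combination (DF (Sum.inl α) (g μ ν) z - DF (Sum.inl μ) (g α ν) z) * Complex.I_sq

lemma Tor_lrr (g : Fin 3 → Fin 3 → Pt → ℂ) (hg : ∀ μ ν, Sm (g μ ν)) (α b c : Fin 3) (z : Pt) :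
    TorF g (Sum.inl α) (Sum.inr b) (Sum.inr c) z
      = DF (Sum.inr c) (g α b) z - DF (Sum.inr b) (g α c) z := by
  simp only [TorF, dTwo, nHol, omF_lr g hg, omF_rr]
  norm_num
  linear_combination (DF (Sum.inr b) (g α c) z - DF (Sum.inr c) (g α b) z) * Complex.I_sq

lemma Tor_rlr (g : Fin 3 → Fin 3 → Pt → ℂ) (hg : ∀ μ ν, Sm (g μ ν)) (b c d : Fin 3) (z : Pt) :
    TorF g (Sum.inr b) (Sum.inl c) (Sum.inr d) z
      = DF (Sum.inr b) (g c d) z - DF (Sum.inr d) (g c b) z := by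
  simp only [TorF, dTwo, nHol, omF_lr g hg, omF_rl g hg, omF_rr]
  norm_num
  linear_combination (DF (Sum.inr d) (g c b) z - DF (Sum.inr b) (g c d) z) * Complex.I_sq

lemma pbar_lrr (g : Fin 3 → Fin 3 → Pt → ℂ) (hg : ∀ μ ν, Sm (g μ ν)) (α b c : Fin 3) :
    pbarOm g (Sum.inl α) (Sum.inr b) (Sum.inr c)
      = fun z => Complex.I * (DF (Sum.inr c) (g α b) z - DF (Sum.inr b) (g α c) z) := by
  funext z
  simp only [pbarOm, dTwo, nHol, omF_lr g hg, omF_rr]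
  norm_num
  ring

lemma pbar_rrl (g : Fin 3 → Fin 3 → Pt → ℂ) (hg : ∀ μ ν, Sm (g μ ν)) (α b c : Fin 3) :
    pbarOm g (Sum.inr b) (Sum.inr c) (Sum.inl α)
      = fun z => Complex.I * (DF (Sum.inr c) (g α b) z - DF (Sum.inr b) (g α c) z) := by
  funext z
  simp only [pbarOm, dTwo, nHol, omF_rl g hg, omF_rr]
  norm_num
  ring

lemma pbar_lrl (g : Fin 3 → Fin 3 → Pt → ℂ) (α b c : Fin 3) :
    pbarOm g (Sum.inl α) (Sum.inr b) (Sum.inl c) = fun _ => 0 := by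
  funext z
  simp [pbarOm, nHol]

lemma iddbar_eq (g : Fin 3 → Fin 3 → Pt → ℂ) (hg : ∀ μ ν, Sm (g μ ν)) (μ ν β α : Fin 3) (z : Pt) :
    iddbarOm g (Sum.inl μ) (Sum.inr ν) (Sum.inr β) (Sum.inl α) z
      = DF (Sum.inr ν) (DF (Sum.inl μ) (g α β)) z - DF (Sum.inr β) (DF (Sum.inl μ) (g α ν)) z
        + DF (Sum.inr β) (DF (Sum.inl α) (g μ ν)) z
        - DF (Sum.inr ν) (DF (Sum.inl α) (g μ β)) z := by
  have key : ∀ (e : Ix) (a b c : Fin 3), DF e (fun z => Complex.I *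
      (DF (Sum.inr c) (g a b) z - DF (Sum.inr b) (g a c) z)) z
      = Complex.I * (DF (Sum.inr c) (DF e (g a b)) z - DF (Sum.inr b) (DF e (g a c)) z) := by
    intro e a b c
    rw [DF_cmul _ _ (((hg _ _).DF _).sub ((hg _ _).DF _)), DF_sub _ ((hg _ _).DF _) ((hg _ _).DF _),
      DF_comm (hg _ _), DF_comm (hg _ _) e]
  simp only [iddbarOm, dThree, nHol, pbar_lrr g hg, pbar_rrl g hg, pbar_lrl, DF_const, key]
  norm_num
  linear_combination (DF (Sum.inr β) (DF (Sum.inl μ) (g α ν)) z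
    - DF (Sum.inr ν) (DF (Sum.inl μ) (g α β)) z
    - (DF (Sum.inr β) (DF (Sum.inl α) (g μ ν)) z
        - DF (Sum.inr ν) (DF (Sum.inl α) (g μ β)) z)) * Complex.I_sq

lemma sum6 (F : Fin 3 → Fin 3 → Fin 3 → Fin 3 → Fin 3 → Fin 3 → ℂ) :
    ∑ a, ∑ b, ∑ c, ∑ d, ∑ e, ∑ f, F a b c d e f
      = ∑ x : Fin 3 × Fin 3 × Fin 3 × Fin 3 × Fin 3 × Fin 3,
        F x.1 x.2.1 x.2.2.1 x.2.2.2.1 x.2.2.2.2.1 x.2.2.2.2.2 := by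
  simp only [Fintype.sum_prod_type]

lemma sum4 (F : Fin 3 → Fin 3 → Fin 3 → Fin 3 → ℂ) :
    ∑ a, ∑ b, ∑ c, ∑ d, F a b c d
      = ∑ x : Fin 3 × Fin 3 × Fin 3 × Fin 3, F x.1 x.2.1 x.2.2.1 x.2.2.2 := by
  simp only [Fintype.sum_prod_type]

/-- the algebraic heart -/
lemma TT_alg (G : Fin 3 → Fin 3 → ℂ) (P Q : Fin 3 → Fin 3 → Fin 3 → ℂ) :
    ∑ α, ∑ μ, ∑ ν, ∑ b, ∑ c, ∑ d, (P μ α ν - P α μ ν) * G μ b * G c ν * G α d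
        * (Q b c d - Q d c b)
      = 2 * (∑ α, ∑ μ, ∑ ν, ∑ b, ∑ c, ∑ d, P α μ ν * G μ b * G c ν * G α d * Q d c b)
        - 2 * (∑ α, ∑ μ, ∑ ν, ∑ b, ∑ c, ∑ d, P α μ ν * G μ b * G c ν * G α d * Q b c d) := by
  have h : ∀ F : Fin 3 → Fin 3 → Fin 3 → Fin 3 → Fin 3 → Fin 3 → ℂ,
      ∑ α, ∑ μ, ∑ ν, ∑ b, ∑ c, ∑ d, F α μ ν b c d
        = ∑ α, ∑ μ, ∑ ν, ∑ b, ∑ c, ∑ d, F μ α ν d c b := by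
    intro F
    rw [sum6, sum6]
    exact Fintype.sum_equiv ⟨fun x => (x.2.1, x.1, x.2.2.1, x.2.2.2.2.2, x.2.2.2.2.1, x.2.2.2.1),
      fun x => (x.2.1, x.1, x.2.2.1, x.2.2.2.2.2, x.2.2.2.2.1, x.2.2.2.1), fun _ => rfl,
      fun _ => rfl⟩ _ _ (fun _ => rfl)
  have hX := h fun α μ ν b c d => P α μ ν * G μ b * G c ν * G α d * Q d c b
  have hY := h fun α μ ν b c d => P α μ ν * G μ b * G c ν * G α d * Q b c d
  rw [two_mul, two_mul]
  nth_rewrite 2 [hX]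
  nth_rewrite 2 [hY]
  simp only [← Finset.sum_add_distrib, ← Finset.sum_sub_distrib]
  refine Finset.sum_congr rfl fun _ _ => Finset.sum_congr rfl fun _ _ => Finset.sum_congr rfl
    fun _ _ => Finset.sum_congr rfl fun _ _ => Finset.sum_congr rfl fun _ _ =>
    Finset.sum_congr rfl fun _ _ => ?_
  ring

lemma C_alg (G : Fin 3 → Fin 3 → ℂ) (P Q : Fin 3 → Fin 3 → Fin 3 → ℂ) :
    ∑ μ, ∑ σ, ∑ ν, ∑ ρ, G μ σ * (-(∑ α, ∑ β, G ν β * Q σ α β * G α ρ) * P μ ν ρ)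
      = -(∑ α, ∑ μ, ∑ ν, ∑ b, ∑ c, ∑ d, P α μ ν * G μ b * G c ν * G α d * Q d c b) := by
  simp only [Finset.mul_sum, Finset.sum_mul, ← Finset.sum_neg_distrib]
  rw [sum6, sum6]
  refine Fintype.sum_equiv ⟨fun (μ, σ, ν, ρ, α, β) => (μ, ν, ρ, β, α, σ),
    fun (μ, ν, ρ, β, α, σ) => (μ, σ, ν, ρ, α, β), fun _ => rfl, fun _ => rfl⟩ _ _ (fun _ => ?_)
  simp only [Equiv.coe_fn_mk]
  ring

lemma D_alg (G : Fin 3 → Fin 3 → ℂ) (P Q : Fin 3 → Fin 3 → Fin 3 → ℂ) :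
    ∑ μ, ∑ σ, ∑ ν, ∑ ρ, G μ σ * (-(∑ α, ∑ β, G ν β * Q σ α β * G α ρ) * P ν μ ρ)
      = -(∑ α, ∑ μ, ∑ ν, ∑ b, ∑ c, ∑ d, P α μ ν * G μ b * G c ν * G α d * Q b c d) := by
  simp only [Finset.mul_sum, Finset.sum_mul, ← Finset.sum_neg_distrib]
  rw [sum6, sum6]
  refine Fintype.sum_equiv ⟨fun (μ, σ, ν, ρ, α, β) => (ν, μ, ρ, σ, α, β),
    fun (ν, μ, ρ, σ, α, β) => (μ, σ, ν, ρ, α, β), fun _ => rfl, fun _ => rfl⟩ _ _ (fun _ => ?_)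
  simp only [Equiv.coe_fn_mk]
  ring

lemma S_alg (G : Fin 3 → Fin 3 → ℂ) (S : Fin 3 → Fin 3 → Fin 3 → Fin 3 → ℂ) :
    ∑ α, ∑ β, G α β * ∑ μ, ∑ ν, G μ ν * (S ν μ α β - S β μ α ν + S β α μ ν - S ν α μ β)
      = 2 * (∑ μ, ∑ σ, ∑ ν, ∑ ρ, G μ σ * (G ν ρ * S σ μ ν ρ))
        - 2 * (∑ μ, ∑ σ, ∑ ν, ∑ ρ, G μ σ * (G ν ρ * S σ ν μ ρ)) := by
  have h : ∀ F : Fin 3 → Fin 3 → Fin 3 → Fin 3 → ℂ,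
      ∑ μ, ∑ σ, ∑ ν, ∑ ρ, F μ σ ν ρ = ∑ μ, ∑ σ, ∑ ν, ∑ ρ, F ν ρ μ σ := by
    intro F
    rw [sum4, sum4]
    exact Fintype.sum_equiv ⟨fun x => (x.2.2.1, x.2.2.2, x.1, x.2.1),
      fun x => (x.2.2.1, x.2.2.2, x.1, x.2.1), fun _ => rfl, fun _ => rfl⟩ _ _ (fun _ => rfl)
  have hA := h fun μ σ ν ρ => G μ σ * (G ν ρ * S σ μ ν ρ)
  have hB := h fun μ σ ν ρ => G μ σ * (G ν ρ * S σ ν μ ρ)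
  rw [two_mul, two_mul]
  nth_rewrite 2 [hA]
  nth_rewrite 2 [hB]
  simp only [Finset.mul_sum, ← Finset.sum_add_distrib, ← Finset.sum_sub_distrib]
  refine Finset.sum_congr rfl fun _ _ => Finset.sum_congr rfl fun _ _ => Finset.sum_congr rfl
    fun _ _ => Finset.sum_congr rfl fun _ _ => ?_
  ring

lemma gF_ll (g : Fin 3 → Fin 3 → Pt → ℂ) (a b : Fin 3) : gF g (Sum.inl a) (Sum.inl b) = 0 := rfl
lemma gF_rr (g : Fin 3 → Fin 3 → Pt → ℂ) (a b : Fin 3) : gF g (Sum.inr a) (Sum.inr b) = 0 := rfl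

lemma Gam_l (g ginv : Fin 3 → Fin 3 → Pt → ℂ) (γ μ ν : Fin 3) (z : Pt) :
    GamLC g ginv (Sum.inl γ) (Sum.inl μ) (Sum.inr ν) z
      = 2⁻¹ * ∑ δ, ginv γ δ z * (DF (Sum.inr ν) (g μ δ) z - DF (Sum.inr δ) (g μ ν) z) := by
  simp [GamLC, Fintype.sum_sum_type, ginvF, gF, DF_zero]

lemma Gam_r (g ginv : Fin 3 → Fin 3 → Pt → ℂ) (γ μ ν : Fin 3) (z : Pt) :
    GamLC g ginv (Sum.inr γ) (Sum.inl μ) (Sum.inr ν) z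
      = 2⁻¹ * ∑ δ, ginv δ γ z * (DF (Sum.inl μ) (g δ ν) z - DF (Sum.inl δ) (g μ ν) z) := by
  simp [GamLC, Fintype.sum_sum_type, ginvF, gF, DF_zero]

lemma gF_symm (g : Fin 3 → Fin 3 → Pt → ℂ) (a b : Ix) : gF g a b = gF g b a := by
  cases a <;> cases b <;> rfl

lemma Gam_symm (g ginv : Fin 3 → Fin 3 → Pt → ℂ) (a b c : Ix) (z : Pt) :
    GamLC g ginv a b c z = GamLC g ginv a c b z := by
  simp only [GamLC, gF_symm g b c]
  congr 1
  exact Finset.sum_congr rfl fun _ _ => by ring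

lemma GGam_l (g ginv : Fin 3 → Fin 3 → Pt → ℂ) (γ : Fin 3) (z : Pt) :
    ∑ μ, ∑ ν, ginv μ ν z * GamLC g ginv (Sum.inl γ) (Sum.inl μ) (Sum.inr ν) z
      = 2⁻¹ * ∑ δ, ginv γ δ z * (Ma g ginv δ z - Lf g ginv (Sum.inr δ) z) := by
  simp only [Gam_l, Ma, Lf, Fin.sum_univ_three]
  ring

lemma GGam_r (g ginv : Fin 3 → Fin 3 → Pt → ℂ) (γ : Fin 3) (z : Pt) :
    ∑ μ, ∑ ν, ginv μ ν z * GamLC g ginv (Sum.inr γ) (Sum.inl μ) (Sum.inr ν) z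
      = 2⁻¹ * ∑ δ, ginv δ γ z * (Mh g ginv δ z - Lf g ginv (Sum.inl δ) z) := by
  simp only [Gam_r, Mh, Lf, Fin.sum_univ_three]
  ring

lemma T1 (g ginv : Fin 3 → Fin 3 → Pt → ℂ) (hg : ∀ μ ν, Sm (g μ ν)) (μ : Fin 3) (z : Pt) :
    ∑ α, ∑ b, ∑ c, ginv μ b z * ginv α c z * TorF g (Sum.inl α) (Sum.inr b) (Sum.inr c) z
      = ∑ b, ginv μ b z * (Ma g ginv b z - Lf g ginv (Sum.inr b) z) := by
  simp only [Tor_lrr g hg, Ma, Lf, Fin.sum_univ_three]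
  ring

lemma T2 (g ginv : Fin 3 → Fin 3 → Pt → ℂ) (hg : ∀ μ ν, Sm (g μ ν)) (μ : Fin 3) (z : Pt) :
    ∑ α, ∑ b, ∑ c, ginv b μ z * ginv α c z * TorF g (Sum.inl α) (Sum.inl b) (Sum.inr c) z
      = ∑ b, ginv b μ z * (Lf g ginv (Sum.inl b) z - Mh g ginv b z) := by
  simp only [Tor_llr g hg, Mh, Lf, Fin.sum_univ_three]
  ring

lemma Lap_eq (g ginv : Fin 3 → Fin 3 → Pt → ℂ) (u : Pt → ℂ) (hu : Sm u) (z : Pt) :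
    LapLC g ginv u z = 2 * (∑ μ, ∑ ν, ginv μ ν z * DF (Sum.inr ν) (DF (Sum.inl μ) u) z)
      - 2 * (∑ γ, (∑ μ, ∑ ν, ginv μ ν z * GamLC g ginv (Sum.inl γ) (Sum.inl μ) (Sum.inr ν) z)
          * DF (Sum.inl γ) u z)
      - 2 * (∑ γ, (∑ μ, ∑ ν, ginv μ ν z * GamLC g ginv (Sum.inr γ) (Sum.inl μ) (Sum.inr ν) z)
          * DF (Sum.inr γ) u z) := by
  have hz : ∀ a b, ginvF ginv (Sum.inl a) (Sum.inl b) z = 0 := fun _ _ => rfl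
  have hz' : ∀ a b, ginvF ginv (Sum.inr a) (Sum.inr b) z = 0 := fun _ _ => rfl
  have hz1 : ∀ a b, ginvF ginv (Sum.inl a) (Sum.inr b) z = ginv a b z := fun _ _ => rfl
  have hz2 : ∀ a b, ginvF ginv (Sum.inr a) (Sum.inl b) z = ginv b a z := fun _ _ => rfl
  simp only [LapLC, Fintype.sum_sum_type, hz, hz', hz1, hz2, zero_mul, Finset.sum_const_zero,
    zero_add, add_zero]
  simp only [Gam_symm g ginv _ (Sum.inr _) (Sum.inl _),
    DF_comm hu (Sum.inl _) (Sum.inr _), Fin.sum_univ_three]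
  ring

theorem main_alg (g ginv : Fin 3 → Fin 3 → Pt → ℂ) (f u : Pt → ℂ)
    (hg : ∀ μ ν, Sm (g μ ν)) (hG : ∀ μ ν, Sm (ginv μ ν)) (hd : ∀ z, detg g z ≠ 0)
    (hinv1 : ∀ z α β, ∑ σ, ginv α σ z * g β σ z = (if α = β then (1:ℂ) else 0))
    (hinv2 : ∀ z σ τ, ∑ α, ginv α σ z * g α τ z = (if σ = τ then (1:ℂ) else 0))
    (hf : Sm f) (hfhol : ∀ μ z, Da μ f z = 0) (hfne : ∀ z, f z ≠ 0) (hu : Sm u)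
    (hN : ∀ z, Complex.exp (u z) * Complex.exp (u z) * detg g z = f z * (starRingEnd ℂ) (f z))
    (hbal : ∀ (a b c d e : Ix) (z : Pt),
      dFour (fun a' b' c' d' w =>
        Complex.exp (u w) * wedge22 (omF g) (omF g) a' b' c' d' w) a b c d e z = 0) (z : Pt) :
      LapLC g ginv u z
        = -(∑ α, ∑ β, ginv α β z * ∑ μ, ∑ ν, ginv μ ν z *
              iddbarOm g (Sum.inl μ) (Sum.inr ν) (Sum.inr β) (Sum.inl α) z)
          + TTcon g ginv z
          - (∑ μ, (∑ α, ∑ b, ∑ c,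
              ginv μ b z * ginv α c z * TorF g (Sum.inl α) (Sum.inr b) (Sum.inr c) z)
              * Dh μ u z)
          + (∑ μ, (∑ α, ∑ b, ∑ c,
              ginv b μ z * ginv α c z * TorF g (Sum.inl α) (Sum.inl b) (Sum.inr c) z)
              * Da μ u z) := by
  have th := tau_h g ginv u hu hg hG hd hinv1 hbal
  have ta := tau_a g ginv u hu hg hG hd hinv1 hinv2 hbal
  have hk := hol_key g ginv u f hu hg hG hd hinv1 hf hfhol hfne hN z
  -- derivative of the balanced condition
  have hm : ∀ σ μ, DF (Sum.inr σ) (DF (Sum.inl μ) u) z + DF (Sum.inr σ) (Lf g ginv (Sum.inl μ)) z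
      - DF (Sum.inr σ) (Mh g ginv μ) z = 0 := by
    intro σ μ
    have h0 := DF_const (Sum.inr σ) 0 z
    rw [← funext (fun w => th w μ), DF_sub _ ((hu.DF _).add (Lf_sm g ginv hg hG _))
      (Mh_sm g ginv hg hG μ), DF_add _ (hu.DF _) (Lf_sm g ginv hg hG _)] at h0
    exact h0
  have dL : ∀ σ μ, ∑ ν, ∑ ρ, (-(∑ α, ∑ β, ginv ν β z * DF (Sum.inr σ) (g α β) z * ginv α ρ z)
      * DF (Sum.inl μ) (g ν ρ) z + ginv ν ρ z * DF (Sum.inr σ) (DF (Sum.inl μ) (g ν ρ)) z)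
      = -2 * DF (Sum.inr σ) (DF (Sum.inl μ) u) z := by
    intro σ μ
    have h := DF_sum2 (Sum.inr σ) hG (fun ν ρ => (hg ν ρ).DF (Sum.inl μ)) z
    simp only [Dginv g ginv hg hG hinv1 hinv2] at h
    rw [← h]
    rw [show DF (Sum.inr σ) (fun w => ∑ i, ∑ j, ginv i j w * DF (Sum.inl μ) (g i j) w) z
      = DF (Sum.inr σ) (Lf g ginv (Sum.inl μ)) z from rfl]
    linear_combination hk σ μ
  have dM : ∀ σ μ, ∑ ν, ∑ ρ, (-(∑ α, ∑ β, ginv ν β z * DF (Sum.inr σ) (g α β) z * ginv α ρ z)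
      * DF (Sum.inl ν) (g μ ρ) z + ginv ν ρ z * DF (Sum.inr σ) (DF (Sum.inl ν) (g μ ρ)) z)
      = - DF (Sum.inr σ) (DF (Sum.inl μ) u) z := by
    intro σ μ
    have h := DF_sum2 (Sum.inr σ) hG (fun ν ρ => (hg μ ρ).DF (Sum.inl ν)) z
    simp only [Dginv g ginv hg hG hinv1 hinv2] at h
    rw [← h]
    rw [show DF (Sum.inr σ) (fun w => ∑ i, ∑ j, ginv i j w * DF (Sum.inl i) (g μ j) w) z
      = DF (Sum.inr σ) (Mh g ginv μ) z from rfl]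
    linear_combination hk σ μ - hm σ μ
  have SL : ∑ μ, ∑ σ, ginv μ σ z * (∑ ν, ∑ ρ,
      (-(∑ α, ∑ β, ginv ν β z * DF (Sum.inr σ) (g α β) z * ginv α ρ z)
      * DF (Sum.inl μ) (g ν ρ) z + ginv ν ρ z * DF (Sum.inr σ) (DF (Sum.inl μ) (g ν ρ)) z))
      = -2 * ∑ μ, ∑ σ, ginv μ σ z * DF (Sum.inr σ) (DF (Sum.inl μ) u) z := by
    simp only [dL, Finset.mul_sum]
    exact Finset.sum_congr rfl fun _ _ => Finset.sum_congr rfl fun _ _ => by ring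
  have SM : ∑ μ, ∑ σ, ginv μ σ z * (∑ ν, ∑ ρ,
      (-(∑ α, ∑ β, ginv ν β z * DF (Sum.inr σ) (g α β) z * ginv α ρ z)
      * DF (Sum.inl ν) (g μ ρ) z + ginv ν ρ z * DF (Sum.inr σ) (DF (Sum.inl ν) (g μ ρ)) z))
      = - ∑ μ, ∑ σ, ginv μ σ z * DF (Sum.inr σ) (DF (Sum.inl μ) u) z := by
    simp only [dM, mul_neg, Finset.sum_neg_distrib]
  have Calg := C_alg (fun μ ν => ginv μ ν z) (fun μ ν ρ => DF (Sum.inl μ) (g ν ρ) z)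
    (fun σ ν ρ => DF (Sum.inr σ) (g ν ρ) z)
  have Dalg := D_alg (fun μ ν => ginv μ ν z) (fun μ ν ρ => DF (Sum.inl μ) (g ν ρ) z)
    (fun σ ν ρ => DF (Sum.inr σ) (g ν ρ) z)
  have Talg := TT_alg (fun μ ν => ginv μ ν z) (fun μ ν ρ => DF (Sum.inl μ) (g ν ρ) z)
    (fun σ ν ρ => DF (Sum.inr σ) (g ν ρ) z)
  have Salg := S_alg (fun μ ν => ginv μ ν z)
    (fun σ μ ν ρ => DF (Sum.inr σ) (DF (Sum.inl μ) (g ν ρ)) z)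
  have split : ∀ (X Y : Fin 3 → Fin 3 → Fin 3 → Fin 3 → ℂ),
      ∑ μ, ∑ σ, ginv μ σ z * (∑ ν, ∑ ρ, (X μ σ ν ρ + Y μ σ ν ρ))
        = (∑ μ, ∑ σ, ∑ ν, ∑ ρ, ginv μ σ z * X μ σ ν ρ)
          + ∑ μ, ∑ σ, ∑ ν, ∑ ρ, ginv μ σ z * Y μ σ ν ρ := by
    intro X Y
    simp only [Finset.mul_sum, mul_add, Finset.sum_add_distrib]
  rw [split (fun μ σ ν ρ => -(∑ α, ∑ β, ginv ν β z * DF (Sum.inr σ) (g α β) z * ginv α ρ z)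
      * DF (Sum.inl μ) (g ν ρ) z)
      (fun μ σ ν ρ => ginv ν ρ z * DF (Sum.inr σ) (DF (Sum.inl μ) (g ν ρ)) z), Calg] at SL
  rw [split (fun μ σ ν ρ => -(∑ α, ∑ β, ginv ν β z * DF (Sum.inr σ) (g α β) z * ginv α ρ z)
      * DF (Sum.inl ν) (g μ ρ) z)
      (fun μ σ ν ρ => ginv ν ρ z * DF (Sum.inr σ) (DF (Sum.inl ν) (g μ ρ)) z), Dalg] at SM
  have hDh : ∀ μ, Dh μ u z = DF (Sum.inl μ) u z := fun _ => rfl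
  have hDa : ∀ μ, Da μ u z = DF (Sum.inr μ) u z := fun _ => rfl
  have r1 : ∀ b, Ma g ginv b z - Lf g ginv (Sum.inr b) z = DF (Sum.inr b) u z := fun b => by
    linear_combination -(ta z b)
  have r2 : ∀ b, Mh g ginv b z - Lf g ginv (Sum.inl b) z = DF (Sum.inl b) u z := fun b => by
    linear_combination -(th z b)
  have r3 : ∀ b, Lf g ginv (Sum.inl b) z - Mh g ginv b z = -DF (Sum.inl b) u z := fun b => by
    linear_combination (th z b)
  rw [Lap_eq g ginv u hu]
  simp only [TTcon, T1 g ginv hg, T2 g ginv hg, GGam_l, GGam_r, iddbar_eq g hg,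
    hDh, hDa, r1, r2, r3]
  rw [Salg]
  simp only [Tor_llr g hg, Tor_rlr g hg]
  rw [Talg]
  have fin : ∀ (x y : Fin 3 → ℂ),
      - 2 * (∑ γ, (2⁻¹ * ∑ δ, ginv γ δ z * y δ) * x γ) - 2 * (∑ γ, (2⁻¹ * ∑ δ, ginv δ γ z * x δ) * y γ)
      = - (∑ μ, (∑ b, ginv μ b z * y b) * x μ) + ∑ μ, (∑ b, ginv b μ z * -x b) * y μ := by
    intro x y
    simp only [Fin.sum_univ_three]; ring
  have fin' := fin (fun μ => DF (Sum.inl μ) u z) (fun μ => DF (Sum.inr μ) u z)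
  linear_combination fin' - 2 * SL.symm + 2 * SM.symm

theorem stmt16 (g ginv : Fin 3 → Fin 3 → Pt → ℂ) (f : Pt → ℂ)
    -- the metric components are smooth
    (hg : ∀ μ ν, ContDiff ℝ (⊤ : ℕ∞) (g μ ν)) (hginvsm : ∀ μ ν, ContDiff ℝ (⊤ : ℕ∞) (ginv μ ν))
    -- hermitian: `conj g_{μν̄} = g_{νμ̄}`, and positive
    (hherm : ∀ μ ν z, (starRingEnd ℂ) (g μ ν z) = g ν μ z)
    (hpos : ∀ z (v : Fin 3 → ℂ), v ≠ 0 →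
      0 < (∑ μ, ∑ ν, g μ ν z * v μ * (starRingEnd ℂ) (v ν)).re)
    -- `ginv` is the inverse metric: `g^{ασ̄} g_{βσ̄} = δ^α_β` and `g^{ασ̄} g_{ατ̄} = δ^σ̄_τ̄`
    (hinv1 : ∀ z α β, ∑ σ, ginv α σ z * g β σ z = (if α = β then (1:ℂ) else 0))
    (hinv2 : ∀ z σ τ, ∑ α, ginv α σ z * g α τ z = (if σ = τ then (1:ℂ) else 0))
    -- `Ω = f dz¹²³` is a holomorphic volume form: `f` is holomorphic and nonvanishing
    (hf : ContDiff ℝ (⊤ : ℕ∞) f)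
    (hfhol : ∀ μ z, Da μ f z = 0)
    (hfne : ∀ z, f z ≠ 0)
    -- the conformally balanced condition `d(‖Ω‖_ω ω²) = 0`
    (hbal : ∀ (a b c d e : Ix) (z : Pt),
      dFour (fun a' b' c' d' w =>
        (nrmOm g f w : ℂ) * wedge22 (omF g) (omF g) a' b' c' d' w) a b c d e z = 0) :
    -- conclusion, with `u = log ‖Ω‖_ω`:
    (let u : Pt → ℂ := fun z => (Real.log (nrmOm g f z) : ℝ);
     ∀ z : Pt,
      LapLC g ginv u z
        = -- `−(i∂∂̄ω)_α{}^{αμ}{}_μ`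
          -(∑ α, ∑ β, ginv α β z * ∑ μ, ∑ ν, ginv μ ν z *
              iddbarOm g (Sum.inl μ) (Sum.inr ν) (Sum.inr β) (Sum.inl α) z)
          -- `+ T_{αμν̄} T^{μν̄α}`
          + TTcon g ginv z
          -- `− T_α{}^{μα} ∂_μ u`
          - (∑ μ, (∑ α, ∑ b, ∑ c,
              ginv μ b z * ginv α c z * TorF g (Sum.inl α) (Sum.inr b) (Sum.inr c) z)
              * Dh μ u z)
          -- `+ T_α{}^{μ̄α} ∂_{μ̄} u`
          + (∑ μ, (∑ α, ∑ b, ∑ c,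
              ginv b μ z * ginv α c z * TorF g (Sum.inl α) (Sum.inl b) (Sum.inr c) z)
              * Da μ u z)) := by
  intro u
  have hdp := det_pos' g hherm hpos
  have hd : ∀ z, detg g z ≠ 0 := by
    intro z h
    have := (hdp z).1
    rw [h] at this
    simp at this
  have hq : ∀ z, 0 < Complex.normSq (f z) / (detg g z).re := fun z =>
    div_pos (Complex.normSq_pos.2 (hfne z)) (hdp z).1
  have hNpos : ∀ z, 0 < nrmOm g f z := fun z => Real.sqrt_pos.2 (hq z)
  have hNu : ∀ z, (nrmOm g f z : ℂ) = Complex.exp (u z) := by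
    intro z
    change _ = Complex.exp ((Real.log (nrmOm g f z) : ℝ) : ℂ)
    rw [← Complex.ofReal_exp, Real.exp_log (hNpos z)]
  have hre : ContDiff ℝ (⊤ : ℕ∞) (fun z => (detg g z).re) :=
    Complex.reCLM.contDiff.comp (Sm.detg hg)
  have hns : ContDiff ℝ (⊤ : ℕ∞) (fun z => Complex.normSq (f z)) := by
    have e : (fun z => Complex.normSq (f z)) = fun z => (f z).re * (f z).re + (f z).im * (f z).im :=
      funext fun z => Complex.normSq_apply _
    rw [e]
    have h1 : ContDiff ℝ (⊤ : ℕ∞) (fun z => (f z).re) := Complex.reCLM.contDiff.comp hf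
    have h2 : ContDiff ℝ (⊤ : ℕ∞) (fun z => (f z).im) := Complex.imCLM.contDiff.comp hf
    exact (h1.mul h1).add (h2.mul h2)
  have hNs : ContDiff ℝ (⊤ : ℕ∞) (nrmOm g f) :=
    (hns.div hre fun z => (hdp z).1.ne').sqrt fun z => (hq z).ne'
  have hu : Sm u := Complex.ofRealCLM.contDiff.comp (hNs.log fun z => (hNpos z).ne')
  have hN : ∀ z, Complex.exp (u z) * Complex.exp (u z) * detg g z
      = f z * (starRingEnd ℂ) (f z) := by
    intro z
    rw [← hNu, (hdp z).2, Complex.mul_conj, ← Complex.ofReal_mul, ← Complex.ofReal_mul, nrmOm,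
      Real.mul_self_sqrt (hq z).le, div_mul_cancel₀ _ (hdp z).1.ne']
  simp only [hNu] at hbal
  exact main_alg g ginv f u hg hginvsm hd hinv1 hinv2 hf hfhol hfne hu hN hbal
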